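/- arXiv:quant-ph/9807008 — 2 statements merged into one kernel-verified Lean document; each statement's English description precedes it below -/
import Mathlib

section
/- Let ρ be a state on M_n(ℂ). (i) If (X_j)_{j∈Ω} is a POVM on M_n(ℂ) with Tr(X_j) ≤ 1 for every j (e.g. a POVM whose elements are rank-one), then the Shannon entropy of the outcome distribution (Tr(ρ X_j))_j is at least the von Neumann entropy H(ρ). (ii) If 𝔇 is a maximal commutative unital *-subalgebra of M_n(ℂ) (equivalently, the algebra of matrices diagonal in some orthonormal basis), then H_ρ(𝔇) ≥ H(ρ). -/
open scoped ComplexOrder Kronecker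
open Matrix

noncomputable def negMulLogb (x : ℝ) : ℝ := -(x * Real.logb 2 x)

noncomputable def shannonEntropy {α : Type*} [Fintype α] (p : α → ℝ) : ℝ :=
  ∑ i, negMulLogb (p i)

noncomputable def mutualInfo {α β : Type*} [Fintype α] [Fintype β]
    (p : α → β → ℝ) : ℝ :=
  shannonEntropy (fun i => ∑ j, p i j) + shannonEntropy (fun j => ∑ i, p i j)
    - shannonEntropy (fun ij : α × β => p ij.1 ij.2)

noncomputable def binEnt (t : ℝ) : ℝ := negMulLogb t + negMulLogb (1 - t)

noncomputable def vnEntropy {α : Type*} [Fintype α] [DecidableEq α]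
    (ρ : Matrix α α ℂ) : ℝ :=
  if h : ρ.IsHermitian then ∑ i, negMulLogb (h.eigenvalues i) else 0

noncomputable def matLogb {α : Type*} [Fintype α] [DecidableEq α]
    (A : Matrix α α ℂ) : Matrix α α ℂ :=
  if h : A.IsHermitian then
    (h.eigenvectorUnitary : Matrix α α ℂ) *
      Matrix.diagonal (fun i => (Real.logb 2 (h.eigenvalues i) : ℂ)) *
      star (h.eigenvectorUnitary : Matrix α α ℂ)
  else 0

def MatState {α : Type*} [Fintype α] [DecidableEq α] (ρ : Matrix α α ℂ) : Prop :=
  ρ.PosSemidef ∧ ρ.trace = 1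

def IsProjn {α : Type*} [Fintype α] [DecidableEq α] (p : Matrix α α ℂ) : Prop :=
  p.IsHermitian ∧ p * p = p

def IsMinProjOf {α : Type*} [Fintype α] [DecidableEq α]
    (X : StarSubalgebra ℂ (Matrix α α ℂ)) (p : Matrix α α ℂ) : Prop :=
  p ∈ X ∧ IsProjn p ∧ p ≠ 0 ∧
    ∀ q ∈ X, IsProjn q → q * p = q → q = 0 ∨ q = p

def IsCanonicalTrace {α : Type*} [Fintype α] [DecidableEq α]
    (X : StarSubalgebra ℂ (Matrix α α ℂ)) (τ : Matrix α α ℂ →ₗ[ℂ] ℂ) : Prop :=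
  (∀ x ∈ X, ∀ y ∈ X, τ (x * y) = τ (y * x)) ∧
  (∀ x ∈ X, 0 ≤ τ (star x * x)) ∧
  (∀ p, IsMinProjOf X p → τ p = 1)

def IsRestriction {α : Type*} [Fintype α] [DecidableEq α]
    (X : StarSubalgebra ℂ (Matrix α α ℂ)) (τ : Matrix α α ℂ →ₗ[ℂ] ℂ)
    (ρ r : Matrix α α ℂ) : Prop :=
  r ∈ X ∧ r.PosSemidef ∧ ∀ x ∈ X, τ (r * x) = (ρ * x).trace

noncomputable def algEntropy {α : Type*} [Fintype α] [DecidableEq α]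
    (τ : Matrix α α ℂ →ₗ[ℂ] ℂ) (r : Matrix α α ℂ) : ℝ :=
  -(τ (r * matLogb r)).re

def IsAlgEntropy {α : Type*} [Fintype α] [DecidableEq α]
    (X : StarSubalgebra ℂ (Matrix α α ℂ)) (ρ : Matrix α α ℂ) (H : ℝ) : Prop :=
  ∃ τ r, IsCanonicalTrace X τ ∧ IsRestriction X τ ρ r ∧ H = algEntropy τ r

def CompatibleAlg {α : Type*} [Fintype α] [DecidableEq α]
    (X Y : StarSubalgebra ℂ (Matrix α α ℂ)) : Prop :=
  ∀ x ∈ X, ∀ y ∈ Y, x * y = y * x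

/-- Pairwise commuting symmetric operators have an orthonormal basis of joint eigenvectors. -/
theorem LinearMap.IsSymmetric.exists_orthonormalBasis_joint_eigenvectors {𝕜 E ι κ : Type*}
    [RCLike 𝕜] [NormedAddCommGroup E] [InnerProductSpace 𝕜 E] [FiniteDimensional 𝕜 E] [Fintype κ]
    (b₁ : OrthonormalBasis κ 𝕜 E) {T : ι → Module.End 𝕜 E} (hT : ∀ i, (T i).IsSymmetric)
    (hC : Pairwise (Function.onFun Commute T)) :
    ∃ b : OrthonormalBasis κ 𝕜 E, ∀ j, ∃ γ : ι → 𝕜, ∀ i, T i (b j) = γ i • b j := by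
  classical
  have hint := directSum_isInternal_of_pairwise_commute hT hC
  let v := fun γ : ι → 𝕜 =>
    stdOrthonormalBasis 𝕜 (⨅ i, Module.End.eigenspace (T i) (γ i) : Submodule 𝕜 E)
  obtain ⟨σ, b₀, hb₀, hev⟩ : ∃ (σ : Type _) (b₀ : Module.Basis σ 𝕜 E), Orthonormal 𝕜 b₀ ∧
      ∀ j, ∃ γ : ι → 𝕜, ∀ i, T i (b₀ j) = γ i • b₀ j :=
    ⟨_, hint.collectedBasis fun γ => (v γ).toBasis,
      DirectSum.IsInternal.collectedBasis_orthonormal (orthogonalFamily_iInf_eigenspaces hT) hint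
        fun γ => by simp [(v γ).orthonormal],
      fun j => ⟨j.1, fun i => Module.End.mem_eigenspace_iff.mp
        ((Submodule.mem_iInf _).mp (hint.collectedBasis_mem (fun γ => (v γ).toBasis) j) i)⟩⟩
  have := FiniteDimensional.fintypeBasisIndex b₀
  let e := b₀.indexEquiv b₁.toBasis
  exact ⟨(b₀.toOrthonormalBasis hb₀).reindex e, fun j => by simpa using hev (e.symm j)⟩

theorem Matrix.exists_unitary_mul_eq_mul_diagonal {n : Type*} [Fintype n] [DecidableEq n]
    (S : Set (Matrix n n ℂ)) (hS : ∀ A ∈ S, A.IsHermitian)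
    (hcomm : ∀ A ∈ S, ∀ B ∈ S, A * B = B * A) :
    ∃ U : unitaryGroup n ℂ, ∀ A ∈ S, ∃ d : n → ℂ, A * U = U * diagonal d := by
  obtain ⟨b, hb⟩ := LinearMap.IsSymmetric.exists_orthonormalBasis_joint_eigenvectors
    (EuclideanSpace.basisFun n ℂ) (T := fun A : S => toEuclideanLin (A : Matrix n n ℂ))
    (fun A => isSymmetric_toEuclideanLin_iff.mpr (hS A A.2))
    (fun A B _ => LinearMap.ext fun v => by
      simp [Module.End.mul_apply, toLpLin_apply, mulVec_mulVec, hcomm A A.2 B B.2])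
  choose γ hγ using hb
  refine ⟨⟨_, (EuclideanSpace.basisFun n ℂ).toMatrix_orthonormalBasis_mem_unitary b⟩,
    fun A hA => ⟨fun j => γ j ⟨A, hA⟩, ?_⟩⟩
  ext i j
  have := congrArg (fun w : EuclideanSpace ℂ n => w i) (hγ j ⟨A, hA⟩)
  simpa [toLpLin_apply, mulVec, dotProduct, Matrix.mul_apply, Module.Basis.toMatrix_apply,
    diagonal_apply, mul_comm] using this

/-- Conjugation of the diagonal matrices by a unitary matrix. -/
noncomputable def Matrix.conjDiagonal {n : Type*} [Fintype n] [DecidableEq n]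
    (U : unitaryGroup n ℂ) : (n → ℂ) →⋆ₐ[ℂ] Matrix n n ℂ :=
  ((Unitary.conjStarAlgAut ℂ (Matrix n n ℂ) U : _ ≃⋆ₐ[ℂ] _) :
      Matrix n n ℂ →⋆ₐ[ℂ] Matrix n n ℂ).comp
    { diagonalAlgHom ℂ with
      map_star' := fun d => by simp [star_eq_conjTranspose, diagonal_conjTranspose] }

section conjDiagonal

variable {n : Type*} [Fintype n] [DecidableEq n] (U : unitaryGroup n ℂ)

theorem Matrix.conjDiagonal_apply (d : n → ℂ) :
    conjDiagonal U d = U * diagonal d * star (U : Matrix n n ℂ) := rfl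

theorem Matrix.conjDiagonal_injective : Function.Injective (conjDiagonal U) := by
  intro c d h
  exact diagonal_injective ((Unitary.conjStarAlgAut ℂ (Matrix n n ℂ) U).injective h)

theorem Matrix.trace_conjDiagonal (d : n → ℂ) : (conjDiagonal U d).trace = ∑ i, d i := by
  rw [conjDiagonal_apply, trace_mul_comm, ← Matrix.mul_assoc]
  simp [trace_diagonal]

theorem Matrix.IsHermitian.eq_conjDiagonal {A : Matrix n n ℂ} (hA : A.IsHermitian) :
    A = conjDiagonal hA.eigenvectorUnitary (fun i => (hA.eigenvalues i : ℂ)) :=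
  hA.spectral_theorem

theorem matLogb_conjDiagonal (c : n → ℝ) :
    matLogb (conjDiagonal U fun i => (c i : ℂ)) =
      conjDiagonal U fun i => (Real.logb 2 (c i) : ℂ) := by
  have hA : (conjDiagonal U fun i => (c i : ℂ)).IsHermitian := by
    rw [IsHermitian, ← star_eq_conjTranspose, ← map_star]
    congr 1
    ext i
    simp
  have hspec := hA.eq_conjDiagonal
  rw [matLogb, dif_pos hA]
  set V := hA.eigenvectorUnitary
  set l := hA.eigenvalues
  have intertwine : ∀ d e : n → ℂ, conjDiagonal U d = conjDiagonal V e ↔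
      diagonal d * (star (U : Matrix n n ℂ) * V) = (star (U : Matrix n n ℂ) * V) * diagonal e := by
    intro d e
    have hU : star (U : Matrix n n ℂ) * U = 1 := UnitaryGroup.star_mul_self U
    have hV : star (V : Matrix n n ℂ) * V = 1 := UnitaryGroup.star_mul_self V
    have hU' : (U : Matrix n n ℂ) * star (U : Matrix n n ℂ) = 1 := mem_unitaryGroup_iff.mp U.2
    have hV' : (V : Matrix n n ℂ) * star (V : Matrix n n ℂ) = 1 := mem_unitaryGroup_iff.mp V.2
    simp only [conjDiagonal_apply]
    constructor
    · intro h
      calc _ = star (U : Matrix n n ℂ) * (U * diagonal d * star (U : Matrix n n ℂ)) * V := by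
            simp only [← Matrix.mul_assoc, hU, Matrix.one_mul]
        _ = _ := by
            rw [h]
            simp only [Matrix.mul_assoc, hV, Matrix.mul_one]
    · intro h
      calc _ = U * (diagonal d * (star (U : Matrix n n ℂ) * V)) * star (V : Matrix n n ℂ) := by
            simp only [Matrix.mul_assoc, hV', Matrix.mul_one]
        _ = _ := by
            rw [h]
            simp only [← Matrix.mul_assoc, hU', Matrix.one_mul]
  refine Eq.symm ((intertwine _ _).mpr ?_)
  have h := (intertwine _ _).mp hspec
  ext i j
  have hij := congrFun (congrFun h i) j
  rw [diagonal_mul, mul_diagonal] at hij ⊢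
  by_cases hW : (star (U : Matrix n n ℂ) * V) i j = 0
  · simp [hW]
  · rw [mul_comm] at hij
    have : c i = l j := by exact_mod_cast mul_left_cancel₀ hW hij
    rw [this, mul_comm]

theorem isMinProjOf_range_conjDiagonal (i : n) :
    IsMinProjOf (conjDiagonal U).range (conjDiagonal U (Pi.single i 1)) := by
  have hinj := conjDiagonal_injective U
  refine ⟨⟨_, rfl⟩, ⟨?_, ?_⟩, ?_, ?_⟩
  · rw [IsHermitian, ← star_eq_conjTranspose, ← map_star, Pi.star_single, star_one]
  · rw [← map_mul, ← Pi.single_mul, one_mul]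
  · rw [← map_zero (conjDiagonal U)]
    exact fun h => by simpa using hinj h
  · rintro _ ⟨c, rfl⟩ ⟨-, hc⟩ hci
    replace hc : c * c = c := hinj ((map_mul _ _ _).trans hc)
    replace hci : c * Pi.single i 1 = c := hinj ((map_mul _ _ _).trans hci)
    have hci' : c = Pi.single i (c i) := by
      conv_lhs => rw [← hci]
      ext j
      by_cases hj : j = i
      · subst hj; simp
      · simp [hj]
    rcases IsIdempotentElem.iff_eq_zero_or_one.mp (congrFun hc i) with h | h
    · left
      change conjDiagonal U c = 0
      rw [hci', h, Pi.single_zero, map_zero]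
    · right
      change conjDiagonal U c = _
      rw [hci', h]

end conjDiagonal

theorem exists_eq_range_conjDiagonal {n : Type*} [Fintype n] [DecidableEq n]
    (𝔇 : StarSubalgebra ℂ (Matrix n n ℂ))
    (hcomm : ∀ x ∈ 𝔇, ∀ y ∈ 𝔇, x * y = y * x)
    (hmax : ∀ 𝔇' : StarSubalgebra ℂ (Matrix n n ℂ),
      (∀ x ∈ 𝔇', ∀ y ∈ 𝔇', x * y = y * x) → 𝔇 ≤ 𝔇' → 𝔇' = 𝔇) :
    ∃ U : unitaryGroup n ℂ, 𝔇 = (conjDiagonal U).range := by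
  obtain ⟨U, hU⟩ := exists_unitary_mul_eq_mul_diagonal
    {A : Matrix n n ℂ | A ∈ 𝔇 ∧ A.IsHermitian} (fun A hA => hA.2)
    (fun A hA B hB => hcomm A hA.1 B hB.1)
  have hherm : ∀ A ∈ 𝔇, A.IsHermitian → A ∈ (conjDiagonal U).range := by
    intro A hA hA'
    obtain ⟨d, hd⟩ := hU A ⟨hA, hA'⟩
    refine ⟨d, ?_⟩
    change conjDiagonal U d = A
    rw [conjDiagonal_apply, ← hd, Matrix.mul_assoc, mem_unitaryGroup_iff.mp U.2, Matrix.mul_one]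
  refine ⟨U, (hmax _ ?_ ?_).symm⟩
  · rintro _ ⟨c, rfl⟩ _ ⟨d, rfl⟩
    exact (map_mul _ c d).symm.trans ((congrArg _ (mul_comm c d)).trans (map_mul _ d c))
  · intro A hA
    rw [← realPart_add_I_smul_imaginaryPart A]
    refine add_mem (hherm _ ?_ (realPart A).2) (SMulMemClass.smul_mem _ (hherm _ ?_ (imaginaryPart A).2))
    · rw [realPart_apply_coe, ← Complex.coe_smul]
      exact SMulMemClass.smul_mem _ (add_mem hA (star_mem hA))
    · rw [imaginaryPart_apply_coe, ← Complex.coe_smul]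
      exact SMulMemClass.smul_mem _ (SMulMemClass.smul_mem _ (sub_mem hA (star_mem hA)))

theorem negMulLogb_eq (x : ℝ) : negMulLogb x = Real.negMulLog x / Real.log 2 := by
  rw [negMulLogb, Real.negMulLog, Real.logb]
  ring

/-- Jensen's inequality for subprobability weights. -/
theorem sum_mul_negMulLogb_le {ι : Type*} [Fintype ι] {w x : ι → ℝ} (hw : ∀ i, 0 ≤ w i)
    (hw₁ : ∑ i, w i ≤ 1) (hx : ∀ i, 0 ≤ x i) :
    ∑ i, w i * negMulLogb (x i) ≤ negMulLogb (∑ i, w i * x i) := by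
  have h := Real.concaveOn_negMulLog.le_map_sum (t := Finset.univ)
    (w := fun o : Option ι => o.elim (1 - ∑ i, w i) w) (p := fun o => o.elim 0 x)
    (by rintro (_ | i) -; exacts [(sub_nonneg.mpr hw₁ : 0 ≤ 1 - ∑ i, w i), hw i])
    (by simp [Fintype.sum_option])
    (by rintro (_ | i) -; exacts [(le_rfl : (0 : ℝ) ≤ 0), hx i])
  simp only [Fintype.sum_option, Option.elim, smul_eq_mul, Real.negMulLog_zero, mul_zero,
    zero_add] at h
  simp only [negMulLogb_eq, mul_div_assoc', ← Finset.sum_div]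
  gcongr

theorem vnEntropy_le_shannonEntropy {n Ω : Type*} [Fintype n] [DecidableEq n] [Fintype Ω]
    {ρ : Matrix n n ℂ} (hρ : ρ.PosSemidef) (X : Ω → Matrix n n ℂ)
    (hXpos : ∀ j, (X j).PosSemidef) (hXsum : ∑ j, X j = 1)
    (hXtr : ∀ j, ((X j).trace).re ≤ 1) :
    vnEntropy ρ ≤ shannonEntropy (fun j => ((ρ * X j).trace).re) := by
  have hH := hρ.isHermitian
  set U := hH.eigenvectorUnitary
  let B : Ω → Matrix n n ℂ := fun j => star (U : Matrix n n ℂ) * X j * U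
  have hBpos : ∀ j i, 0 ≤ (B j i i).re := fun j i =>
    (Complex.nonneg_iff.mp
      ((hXpos j).conjTranspose_mul_mul_same (U : Matrix n n ℂ)).diag_nonneg).1
  have hBsum : ∀ i, ∑ j, (B j i i).re = 1 := fun i => by
    have : ∑ j, B j = 1 := by
      simp only [B, ← Finset.mul_sum, ← Finset.sum_mul, hXsum, Matrix.mul_one]
      exact UnitaryGroup.star_mul_self U
    rw [← Complex.re_sum, ← Matrix.sum_apply, this]
    simp
  have hBtr : ∀ j, ∑ i, (B j i i).re = (X j).trace.re := fun j => by
    rw [← Complex.re_sum]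
    change (B j).trace.re = _
    rw [trace_mul_comm, ← Matrix.mul_assoc, mem_unitaryGroup_iff.mp U.2, Matrix.one_mul]
  have hprob : ∀ j, (ρ * X j).trace.re = ∑ i, (B j i i).re * hH.eigenvalues i := fun j => by
    have : (ρ * X j).trace = (diagonal (fun i => (hH.eigenvalues i : ℂ)) * B j).trace := by
      conv_lhs => rw [hH.eq_conjDiagonal, conjDiagonal_apply]
      rw [Matrix.mul_assoc, Matrix.mul_assoc, trace_mul_comm, Matrix.mul_assoc]
    rw [this]
    simp [trace, diagonal_mul, mul_comm]
  rw [vnEntropy, dif_pos hH, shannonEntropy]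
  calc ∑ i, negMulLogb (hH.eigenvalues i)
      = ∑ i, ∑ j, (B j i i).re * negMulLogb (hH.eigenvalues i) := by
        simp only [← Finset.sum_mul, hBsum, one_mul]
    _ = ∑ j, ∑ i, (B j i i).re * negMulLogb (hH.eigenvalues i) := Finset.sum_comm
    _ ≤ _ := Finset.sum_le_sum fun j _ => by
        rw [hprob]
        exact sum_mul_negMulLogb_le (hBpos j) ((hBtr j).trans_le (hXtr j)) hρ.eigenvalues_nonneg

theorem vnEntropy_le_of_isAlgEntropy_range_conjDiagonal {n : Type*} [Fintype n] [DecidableEq n]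
    {ρ : Matrix n n ℂ} (hρ : ρ.PosSemidef) (U : unitaryGroup n ℂ) {H : ℝ}
    (hH : IsAlgEntropy (conjDiagonal U).range ρ H) : vnEntropy ρ ≤ H := by
  obtain ⟨τ, r, ⟨-, -, hτ⟩, ⟨⟨c, rfl⟩, hpos, hr⟩, rfl⟩ := hH
  change (conjDiagonal U c).PosSemidef at hpos
  change ∀ x ∈ (conjDiagonal U).range, τ (conjDiagonal U c * x) = _ at hr
  change _ ≤ algEntropy τ (conjDiagonal U c)
  have hτsum : ∀ d : n → ℂ, τ (conjDiagonal U d) = ∑ i, d i := fun d => by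
    have : d = ∑ i, d i • (Pi.single i 1 : n → ℂ) := by
      ext j
      simp [Finset.sum_apply, Pi.single_apply]
    conv_lhs => rw [this]
    simp only [map_sum, map_smul, hτ _ (isMinProjOf_range_conjDiagonal U _), smul_eq_mul, mul_one]
  obtain ⟨p, rfl⟩ : ∃ p : n → ℝ, c = fun i => (p i : ℂ) := by
    refine ⟨fun i => (c i).re, funext fun i => ?_⟩
    have hstar : star c = c := conjDiagonal_injective U ((map_star _ _).trans hpos.isHermitian)
    exact (Complex.conj_eq_iff_re.mp (congrFun hstar i)).symm
  have hp : ∀ i, p i = (ρ * conjDiagonal U (Pi.single i 1)).trace.re := fun i => by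
    rw [← hr (conjDiagonal U _) ⟨_, rfl⟩, ← map_mul, hτsum]
    simp [Pi.single_apply]
  have hent : algEntropy τ (conjDiagonal U fun i => (p i : ℂ)) = shannonEntropy p := by
    rw [algEntropy, matLogb_conjDiagonal, ← map_mul, hτsum, shannonEntropy]
    simp [negMulLogb, ← Complex.ofReal_mul]
  rw [hent, funext hp]
  refine vnEntropy_le_shannonEntropy hρ _ (fun i => ?_) ?_ fun i => ?_
  · obtain ⟨-, ⟨hherm, hidem⟩, -⟩ := isMinProjOf_range_conjDiagonal U i
    rw [← hidem]
    nth_rewrite 1 [← hherm.eq]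
    exact posSemidef_conjTranspose_mul_self _
  · rw [← map_sum, ← map_one (conjDiagonal U)]
    exact congrArg _ (Finset.univ_sum_single (1 : n → ℂ))
  · rw [trace_conjDiagonal]
    simp

/-- (i) the outcome distribution of a POVM all of whose elements have
trace at most 1 has Shannon entropy at least the von Neumann entropy of the state;
(ii) the entropy of a state restricted to a maximal commutative unital
*-subalgebra is at least its von Neumann entropy. -/
theorem measurement_entropy_ge_vnEntropy {n : ℕ} {Ω : Type} [Fintype Ω]
    (ρ : Matrix (Fin n) (Fin n) ℂ) (hρ : MatState ρ)
    -- (i) a POVM with small elements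
    (X : Ω → Matrix (Fin n) (Fin n) ℂ)
    (hXpos : ∀ j, (X j).PosSemidef) (hXsum : ∑ j, X j = 1)
    (hXtr : ∀ j, ((X j).trace).re ≤ 1)
    -- (ii) a maximal commutative unital *-subalgebra
    (𝔇 : StarSubalgebra ℂ (Matrix (Fin n) (Fin n) ℂ))
    (h𝔇comm : ∀ x ∈ 𝔇, ∀ y ∈ 𝔇, x * y = y * x)
    (h𝔇max : ∀ 𝔇' : StarSubalgebra ℂ (Matrix (Fin n) (Fin n) ℂ),
      (∀ x ∈ 𝔇', ∀ y ∈ 𝔇', x * y = y * x) → 𝔇 ≤ 𝔇' → 𝔇' = 𝔇)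
    (HD : ℝ) (hHD : IsAlgEntropy 𝔇 ρ HD) :
    vnEntropy ρ ≤ shannonEntropy (fun j => ((ρ * X j).trace).re) ∧
    vnEntropy ρ ≤ HD := by
  refine ⟨vnEntropy_le_shannonEntropy hρ.1 X hXpos hXsum hXtr, ?_⟩
  obtain ⟨U, rfl⟩ := exists_eq_range_conjDiagonal 𝔇 h𝔇comm h𝔇max
  exact vnEntropy_le_of_isAlgEntropy_range_conjDiagonal hρ.1 U hHD
end

section
/- Let 𝔛 and 𝔜 be compatible unital *-subalgebras of M_n(ℂ) and ρ a state on M_n(ℂ) such that the restriction ρ|_{𝔛𝔜} is a pure state, i.e. a minimal projection of the algebra 𝔛𝔜. Then H_ρ(𝔛) = H_ρ(𝔜). -/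
open scoped ComplexOrder Kronecker
open Matrix

theorem exists_trace_frame {n : ℕ} (S : Submodule ℂ (Matrix (Fin n) (Fin n) ℂ)) :
    ∃ (m : ℕ) (b : Fin m → Matrix (Fin n) (Fin n) ℂ), (∀ i, b i ∈ S) ∧
      ∀ x ∈ S, ∑ i, (x * star (b i)).trace • b i = x := by
  let _ : NormedAddCommGroup (Matrix (Fin n) (Fin n) ℂ) :=
    Matrix.toMatrixNormedAddCommGroup 1 Matrix.PosDef.one
  let _ : InnerProductSpace ℂ (Matrix (Fin n) (Fin n) ℂ) :=
    Matrix.toMatrixInnerProductSpace 1 Matrix.PosSemidef.one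
  have hinner : ∀ x y : Matrix (Fin n) (Fin n) ℂ, inner ℂ x y = (y * star x).trace := by
    intro x y
    change (y * 1 * xᴴ).trace = _
    rw [mul_one]; rfl
  let b := stdOrthonormalBasis ℂ S
  refine ⟨_, fun i => (b i : Matrix (Fin n) (Fin n) ℂ), fun i => (b i).2, fun x hx => ?_⟩
  have h := congrArg (Subtype.val) (b.sum_repr' ⟨x, hx⟩)
  simpa [hinner] using h

theorem IsHermitian.conj_diagonal_eval_eq_aeval {n : ℕ} {A : Matrix (Fin n) (Fin n) ℂ}
    (hA : A.IsHermitian) (P : Polynomial ℂ) :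
    (hA.eigenvectorUnitary : Matrix (Fin n) (Fin n) ℂ) *
      Matrix.diagonal (fun i => P.eval (hA.eigenvalues i : ℂ)) *
      star (hA.eigenvectorUnitary : Matrix (Fin n) (Fin n) ℂ) = Polynomial.aeval A P := by
  have hd : ∀ d : Fin n → ℂ, Polynomial.aeval (Matrix.diagonal d) P
      = Matrix.diagonal (fun i => P.eval (d i)) := by
    intro d
    have := Polynomial.aeval_algHom_apply (Matrix.diagonalAlgHom (n := Fin n) (α := ℂ) ℂ) d P
    rw [Matrix.diagonalAlgHom_apply] at this
    rw [this, Matrix.diagonalAlgHom_apply]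
    congr 1
    funext i
    simp
  conv_rhs => rw [hA.spectral_theorem]
  have := Polynomial.aeval_algHom_apply
    ((Unitary.conjStarAlgAut ℂ (Matrix (Fin n) (Fin n) ℂ) hA.eigenvectorUnitary).toAlgEquiv.toAlgHom)
    (diagonal (RCLike.ofReal ∘ hA.eigenvalues)) P
  refine Eq.trans ?_ this.symm
  rw [hd]
  simp [Unitary.conjStarAlgAut_apply]

theorem IsMinProjOf.exists_smul_of_isHermitian {n : ℕ}
    {X : StarSubalgebra ℂ (Matrix (Fin n) (Fin n) ℂ)} {e h : Matrix (Fin n) (Fin n) ℂ}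
    (he : IsMinProjOf X e) (hX : h ∈ X) (hh : h.IsHermitian) (h1 : e * h = h) (h2 : h * e = h) :
    ∃ c : ℂ, h = c • e := by
  classical
  obtain ⟨heX, ⟨heh, hee⟩, he0, hmin⟩ := he
  let U : Matrix (Fin n) (Fin n) ℂ := hh.eigenvectorUnitary
  have hUU : star U * U = 1 := Unitary.coe_star_mul_self hh.eigenvectorUnitary
  have hUU' : U * star U = 1 := Unitary.coe_mul_star_self hh.eigenvectorUnitary
  let s : Finset ℂ := Finset.univ.image (fun i => (hh.eigenvalues i : ℂ))
  let d : ℂ → Matrix (Fin n) (Fin n) ℂ := fun c =>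
    Matrix.diagonal (fun i => if (hh.eigenvalues i : ℂ) = c then 1 else 0)
  let q : ℂ → Matrix (Fin n) (Fin n) ℂ := fun c => U * d c * star U
  have hqP : ∀ c, ∃ P : Polynomial ℂ, q c = Polynomial.aeval h P := by
    intro c
    refine ⟨Lagrange.interpolate s id (fun z => if z = c then 1 else 0), ?_⟩
    rw [← IsHermitian.conj_diagonal_eval_eq_aeval hh]
    simp only [q, d, U]
    congr 3
    funext i
    have := Lagrange.eval_interpolate_at_node (s := s) (v := id)
      (fun z : ℂ => if z = c then (1 : ℂ) else 0) (i := (hh.eigenvalues i : ℂ))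
      (Set.injOn_id _) (by simp [s])
    exact this.symm
  have hqX : ∀ c, q c ∈ X := by
    intro c
    obtain ⟨P, hP⟩ := hqP c
    rw [hP]
    exact Algebra.adjoin_le (S := X.toSubalgebra) (by simpa using hX)
      (Polynomial.aeval_mem_adjoin_singleton (R := ℂ) (p := P) h)
  have hqe : ∀ c, Commute (q c) e := by
    intro c
    obtain ⟨P, hP⟩ := hqP c
    rw [hP]
    have hc : h ∈ Subalgebra.centralizer ℂ ({e} : Set (Matrix (Fin n) (Fin n) ℂ)) := by
      rw [Subalgebra.mem_centralizer_iff]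
      rintro g rfl
      rw [h1, h2]
    have := Algebra.adjoin_le (S := Subalgebra.centralizer ℂ ({e} : Set (Matrix (Fin n) (Fin n) ℂ)))
      (Set.singleton_subset_iff.2 hc) (Polynomial.aeval_mem_adjoin_singleton (R := ℂ) (p := P) h)
    exact (Subalgebra.mem_centralizer_iff ℂ |>.1 this e rfl).symm
  have hqq : ∀ c, q c * q c = q c := by
    intro c
    calc q c * q c = U * (d c * (star U * U) * d c) * star U := by simp only [q, mul_assoc]
      _ = q c := by rw [hUU, mul_one]; simp [q, d, Matrix.diagonal_mul_diagonal, ← ite_and]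
  have hqs : ∀ c, star (q c) = q c := by
    intro c
    simp only [q, star_mul, star_star, mul_assoc]
    congr 2
    simp only [d, star_eq_conjTranspose, diagonal_conjTranspose]
    congr 1
    funext i
    simp only [Pi.star_apply]
    split_ifs <;> simp
  have hhq : ∀ c, h * q c = c • q c := by
    intro c
    have hsp : h = U * Matrix.diagonal (fun i => (hh.eigenvalues i : ℂ)) * star U := by
      have := IsHermitian.conj_diagonal_eval_eq_aeval hh Polynomial.X
      simpa using this.symm
    calc h * q c = U * (Matrix.diagonal (fun i => (hh.eigenvalues i : ℂ)) * (star U * U) * d c)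
            * star U := by
          conv_lhs => rw [hsp]
          simp only [q, mul_assoc]
      _ = U * (c • d c) * star U := by
          rw [hUU, mul_one]
          congr 2
          simp only [d, Matrix.diagonal_mul_diagonal, ← Matrix.diagonal_smul]
          congr 1
          funext i
          simp only [Pi.smul_apply, smul_eq_mul]
          split_ifs with hi
          · rw [hi]
          · simp
      _ = c • q c := by simp [q]
  have hsum : ∑ c ∈ s, q c = 1 := by
    have : ∑ c ∈ s, d c = 1 := by
      simp only [d]
      ext i j
      rw [Matrix.sum_apply]
      by_cases hij : i = j
      · subst hij
        simp [s]
      · simp [hij]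
    simp only [q]
    rw [← Finset.sum_mul, ← Finset.mul_sum, this, mul_one, hUU']
  have hex : ∃ c, q c * e ≠ 0 := by
    by_contra! hcon
    apply he0
    calc e = (∑ c ∈ s, q c) * e := by rw [hsum, one_mul]
      _ = 0 := by rw [Finset.sum_mul]; simp [hcon]
  obtain ⟨c, hc⟩ := hex
  have hqec : q c * e = e := by
    refine (hmin (q c * e) (mul_mem (hqX c) heX) ⟨?_, ?_⟩ ?_).resolve_left hc
    · change star (q c * e) = q c * e
      rw [star_mul, hqs, show star e = e from heh, (hqe c).eq]
    · calc q c * e * (q c * e) = q c * (e * q c) * e := by simp only [mul_assoc]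
        _ = (q c * q c) * (e * e) := by rw [← (hqe c).eq]; simp only [mul_assoc]
        _ = q c * e := by rw [hqq, hee]
    · rw [mul_assoc, hee]
  refine ⟨c, ?_⟩
  calc h = h * (q c * e) := by rw [hqec, h2]
    _ = c • e := by rw [← mul_assoc, hhq, smul_mul_assoc, hqec]

theorem IsMinProjOf.exists_smul {n : ℕ}
    {X : StarSubalgebra ℂ (Matrix (Fin n) (Fin n) ℂ)} {e a : Matrix (Fin n) (Fin n) ℂ}
    (he : IsMinProjOf X e) (ha : a ∈ X) : ∃ c : ℂ, e * a * e = c • e := by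
  have heX := he.1
  have hes : star e = e := he.2.1.1
  have hee : e * e = e := he.2.1.2
  have key : ∀ b ∈ X, star b = b → ∃ c : ℂ, e * b * e = c • e := by
    intro b hb hbs
    refine he.exists_smul_of_isHermitian (mul_mem (mul_mem heX hb) heX) ?_ ?_ ?_
    · change star (e * b * e) = _
      simp only [star_mul, hes, hbs, mul_assoc]
    · simp only [← mul_assoc, hee]
    · simp only [mul_assoc, hee]
  obtain ⟨c, hc⟩ := key (a + star a) (add_mem ha (star_mem ha)) (by simp [add_comm])
  obtain ⟨d, hd⟩ := key (Complex.I • (a - star a))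
    (X.smul_mem (sub_mem ha (star_mem ha)) _) (by simp [← smul_neg])
  refine ⟨(1 / 2) * (c - Complex.I * d), ?_⟩
  have : a = (1 / 2 : ℂ) • ((a + star a) - Complex.I • (Complex.I • (a - star a))) := by
    rw [smul_smul, Complex.I_mul_I]
    module
  rw [mul_smul, sub_smul, mul_smul, ← hc, ← hd]
  conv_lhs => rw [this]
  simp only [mul_smul_comm, smul_mul_assoc, mul_sub, sub_mul]

theorem IsCanonicalTrace.mul_mul_eq_smul {n : ℕ}
    {X : StarSubalgebra ℂ (Matrix (Fin n) (Fin n) ℂ)} {τ : Matrix (Fin n) (Fin n) ℂ →ₗ[ℂ] ℂ}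
    (hτ : IsCanonicalTrace X τ) {e a : Matrix (Fin n) (Fin n) ℂ}
    (he : IsMinProjOf X e) (ha : a ∈ X) : e * a * e = τ (e * a) • e := by
  obtain ⟨c, hc⟩ := he.exists_smul ha
  have h : τ (e * a * e) = τ (e * a) := by
    rw [hτ.1 _ (mul_mem he.1 ha) _ he.1, ← mul_assoc, he.2.1.2]
  rw [hc, map_smul, hτ.2.2 e he, smul_eq_mul, mul_one] at h
  rw [hc, h]

theorem exists_isMinProjOf_mul_ne_zero {n : ℕ}
    (X : StarSubalgebra ℂ (Matrix (Fin n) (Fin n) ℂ)) {m : Matrix (Fin n) (Fin n) ℂ}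
    (hm : m ≠ 0) : ∃ e, IsMinProjOf X e ∧ e * m ≠ 0 := by
  let F : Matrix (Fin n) (Fin n) ℂ → Submodule ℂ (Matrix (Fin n) (Fin n) ℂ) :=
    fun e => LinearMap.range (LinearMap.mulLeft ℂ e)
  let T : Set (Matrix (Fin n) (Fin n) ℂ) := {e | e ∈ X ∧ IsProjn e ∧ e * m ≠ 0}
  have hT : (1 : Matrix (Fin n) (Fin n) ℂ) ∈ T :=
    ⟨one_mem X, ⟨Matrix.isHermitian_one, mul_one 1⟩, by simpa using hm⟩
  obtain ⟨e, ⟨heX, ⟨hes, hee⟩, hem⟩, hmin⟩ :=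
    (InvImage.wf F (wellFounded_lt (α := Submodule ℂ (Matrix (Fin n) (Fin n) ℂ)))).has_min T ⟨1, hT⟩
  replace hes : star e = e := hes
  have step : ∀ q ∈ X, IsProjn q → q * e = q → q * m ≠ 0 → q = e := by
    intro q hq hqp hqe hqm
    have hqs : star q = q := hqp.1
    have heq : e * q = q := by
      have := congrArg star hqe
      rwa [star_mul, hqs, hes] at this
    have hle : F q ≤ F e := by
      rintro _ ⟨a, rfl⟩
      exact ⟨q * a, by simp [← mul_assoc, heq]⟩
    have hnlt : ¬ F q < F e := hmin q ⟨hq, hqp, hqm⟩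
    have hFe : F q = F e := by
      by_contra hne
      exact hnlt (lt_of_le_of_ne hle hne)
    have : e ∈ F q := by
      rw [hFe]; exact ⟨e, by simp [hee]⟩
    obtain ⟨a, ha⟩ := this
    have ha' : q * a = e := ha
    calc q = q * e := hqe.symm
      _ = e := by rw [← ha', ← mul_assoc, hqp.2]
  refine ⟨e, ⟨heX, ⟨hes, hee⟩, fun h => hem (by rw [h, zero_mul]), fun q hq hqp hqe => ?_⟩, hem⟩
  have hqs : star q = q := hqp.1
  have heq : e * q = q := by
    have := congrArg star hqe
    rwa [star_mul, hqs, hes] at this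
  by_cases hqm : q * m = 0
  · left
    have h1 : e - q = e := by
      refine step (e - q) (sub_mem heX hq) ⟨?_, ?_⟩ ?_ ?_
      · change star (e - q) = _
        rw [star_sub, hes, hqs]
      · rw [sub_mul, mul_sub, mul_sub, hee, heq, hqe, hqp.2]; simp
      · rw [sub_mul, hee, hqe]
      · rwa [sub_mul, hqm, sub_zero]
    simpa using h1
  · exact Or.inr (step q hq hqp hqe hqm)

theorem IsMinProjOf.exists_frame {n : ℕ}
    {X : StarSubalgebra ℂ (Matrix (Fin n) (Fin n) ℂ)} {e : Matrix (Fin n) (Fin n) ℂ}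
    (he : IsMinProjOf X e) :
    ∃ (m : ℕ) (x : Fin m → Matrix (Fin n) (Fin n) ℂ), (∀ i, x i ∈ X) ∧ (∀ i, e * x i = x i) ∧
      (∀ b ∈ X, (∑ i, star (x i) * x i) * b = b * ∑ i, star (x i) * x i) ∧
      (∑ i, star (x i) * x i) * e = e := by
  have heX := he.1
  have hes : star e = e := he.2.1.1
  have hee : e * e = e := he.2.1.2
  let S : Submodule ℂ (Matrix (Fin n) (Fin n) ℂ) :=
    X.toSubalgebra.toSubmodule.map (LinearMap.mulLeft ℂ e)
  have hS : ∀ a, a ∈ S ↔ a ∈ X ∧ e * a = a := by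
    intro a
    constructor
    · rintro ⟨b, hb, rfl⟩
      exact ⟨mul_mem heX hb, by simp [← mul_assoc, hee]⟩
    · rintro ⟨h1, h2⟩
      exact ⟨a, h1, h2⟩
  obtain ⟨m, b, hbS, hb⟩ := exists_trace_frame S
  have htr : 0 ≤ e.trace := by
    have : e = eᴴ * e := by
      rw [← star_eq_conjTranspose, hes, hee]
    rw [this]
    exact (Matrix.posSemidef_conjTranspose_mul_self e).trace_nonneg
  obtain ⟨t, ht0, ht⟩ : ∃ t : ℝ, 0 ≤ t ∧ e.trace = t := by
    refine ⟨e.trace.re, (Complex.nonneg_iff.1 htr).1, ?_⟩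
    apply Complex.ext <;> simp [(Complex.nonneg_iff.1 htr).2.symm]
  let x : Fin m → Matrix (Fin n) (Fin n) ℂ := fun i => ((Real.sqrt t : ℝ) : ℂ) • b i
  have hxX : ∀ i, x i ∈ X := fun i => X.smul_mem ((hS _).1 (hbS i)).1 _
  have hex : ∀ i, e * x i = x i := fun i => by
    simp only [x, mul_smul_comm, ((hS _).1 (hbS i)).2]
  set z := ∑ i, star (x i) * x i with hz
  have hzs : star z = z := by simp [hz, star_sum]
  have hfr : ∀ a ∈ X, e * a * z = e * a := by
    intro a ha
    have haS : e * a ∈ S := (hS _).2 ⟨mul_mem heX ha, by rw [← mul_assoc, hee]⟩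
    conv_rhs => rw [← hb _ haS]
    rw [hz, Finset.mul_sum]
    refine Finset.sum_congr rfl fun i _ => ?_
    obtain ⟨c, hc⟩ := he.exists_smul (mul_mem ha (star_mem ((hS _).1 (hbS i)).1))
    have hbe : star (b i) * e = star (b i) := by
      have := congrArg star ((hS _).1 (hbS i)).2
      rwa [star_mul, hes] at this
    have hc' : e * a * star (b i) = c • e := by
      rw [← hc]; simp only [mul_assoc, hbe]
    have hst : ((Real.sqrt t : ℝ) : ℂ) * ((Real.sqrt t : ℝ) : ℂ) = e.trace := by
      rw [ht, ← Complex.ofReal_mul, Real.mul_self_sqrt ht0]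
    calc e * a * (star (x i) * x i)
        = (((Real.sqrt t : ℝ) : ℂ) * ((Real.sqrt t : ℝ) : ℂ)) • (e * a * star (b i) * b i) := by
          simp only [x, star_smul, smul_mul_assoc, mul_smul_comm, smul_smul, RCLike.star_def,
            Complex.conj_ofReal, mul_assoc]
      _ = (e * a * star (b i)).trace • b i := by
          rw [hst, hc', smul_mul_assoc, ((hS _).1 (hbS i)).2, Matrix.trace_smul, smul_smul,
            smul_eq_mul, mul_comm]
  have hfr' : ∀ a ∈ X, z * a * e = a * e := by
    intro a ha
    have := congrArg star (hfr (star a) (star_mem ha))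
    simpa only [star_mul, star_star, hzs, hes, mul_assoc] using this
  have hzaz : ∀ a ∈ X, z * a * z = a * z := by
    intro a ha
    conv_lhs => rw [hz, Finset.mul_sum]
    conv_rhs => rw [hz, Finset.mul_sum]
    refine Finset.sum_congr rfl fun i _ => ?_
    have hxe : star (x i) * e = star (x i) := by
      have := congrArg star (hex i)
      rwa [star_mul, hes] at this
    have := hfr' (a * star (x i)) (mul_mem ha (star_mem (hxX i)))
    rw [mul_assoc, mul_assoc a, hxe] at this
    rw [← mul_assoc, mul_assoc z a, this, mul_assoc]
  refine ⟨m, x, hxX, hex, fun a ha => ?_, ?_⟩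
  · have := congrArg star (hzaz (star a) (star_mem ha))
    simp only [star_mul, star_star, hzs] at this
    rw [← this, ← mul_assoc, hzaz a ha]
  · simpa using hfr' 1 (one_mem X)

theorem CompatibleAlg.mem_mul_of_mem_sup {n : ℕ}
    {X Y : StarSubalgebra ℂ (Matrix (Fin n) (Fin n) ℂ)} (hXY : CompatibleAlg X Y)
    {a : Matrix (Fin n) (Fin n) ℂ} (ha : a ∈ X ⊔ Y) :
    a ∈ X.toSubalgebra.toSubmodule * Y.toSubalgebra.toSubmodule := by
  set SX := X.toSubalgebra.toSubmodule with hSX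
  set SY := Y.toSubalgebra.toSubmodule with hSY
  have hX1 : (1 : Matrix (Fin n) (Fin n) ℂ) ∈ SX := one_mem X
  have hY1 : (1 : Matrix (Fin n) (Fin n) ℂ) ∈ SY := one_mem Y
  have hcomm : SX * SY = SY * SX := Submodule.mul_comm_of_commute hXY
  have hXX : SX * SX = SX := X.toSubalgebra.isIdempotentElem_toSubmodule
  have hYY : SY * SY = SY := Y.toSubalgebra.isIdempotentElem_toSubmodule
  have hsq : SX * SY * (SX * SY) = SX * SY := by
    calc SX * SY * (SX * SY) = SX * (SY * SX) * SY := by simp only [mul_assoc]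
      _ = SX * SX * (SY * SY) := by rw [← hcomm]; simp only [mul_assoc]
      _ = SX * SY := by rw [hXX, hYY]
  let W : StarSubalgebra ℂ (Matrix (Fin n) (Fin n) ℂ) :=
    { carrier := (SX * SY : Submodule ℂ (Matrix (Fin n) (Fin n) ℂ))
      mul_mem' := fun {a b} ha hb => by
        have := Submodule.mul_mem_mul ha hb
        rwa [hsq] at this
      add_mem' := fun ha hb => add_mem ha hb
      algebraMap_mem' := fun c => by
        rw [Algebra.algebraMap_eq_smul_one]
        refine Submodule.smul_mem _ c ?_
        simpa using Submodule.mul_mem_mul hX1 hY1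
      star_mem' := fun {a} ha => by
        refine Submodule.mul_induction_on ha (fun x hx y hy => ?_) (fun x y hx hy => ?_)
        · rw [star_mul, ← hXY (star x) (star_mem (s := X) hx) (star y) (star_mem (s := Y) hy)]
          exact Submodule.mul_mem_mul (star_mem (s := X) hx) (star_mem (s := Y) hy)
        · rw [star_add]
          exact add_mem hx hy }
  have hXW : X ≤ W := fun x hx => by
    have : x * 1 ∈ SX * SY := Submodule.mul_mem_mul hx hY1
    rwa [mul_one] at this
  have hYW : Y ≤ W := fun y hy => by
    have : 1 * y ∈ SX * SY := Submodule.mul_mem_mul hX1 hy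
    rwa [one_mul] at this
  exact sup_le hXW hYW ha

theorem exists_smul_of_mem_sup {n : ℕ}
    {X Y : StarSubalgebra ℂ (Matrix (Fin n) (Fin n) ℂ)} (hXY : CompatibleAlg X Y)
    {e f a : Matrix (Fin n) (Fin n) ℂ} (he : IsMinProjOf X e) (hf : IsMinProjOf Y f)
    (ha : a ∈ X ⊔ Y) : ∃ c : ℂ, e * f * a * (e * f) = c • (e * f) := by
  refine Submodule.mul_induction_on (hXY.mem_mul_of_mem_sup ha)
    (fun x hx y hy => ?_) (fun a b => ?_)
  · obtain ⟨c, hc⟩ := he.exists_smul (a := x) hx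
    obtain ⟨d, hd⟩ := hf.exists_smul (a := y) hy
    refine ⟨c * d, ?_⟩
    have h1 : f * x = x * f := (hXY x hx f hf.1).symm
    have h2 : f * e = e * f := (hXY e he.1 f hf.1).symm
    have h3 : y * e = e * y := (hXY e he.1 y hy).symm
    calc e * f * (x * y) * (e * f) = e * (f * x) * (y * e) * f := by simp only [mul_assoc]
      _ = e * x * (f * e) * y * f := by rw [h1, h3]; simp only [mul_assoc]
      _ = (e * x * e) * (f * y * f) := by rw [h2]; simp only [mul_assoc]
      _ = (c * d) • (e * f) := by rw [hc, hd, smul_mul_smul_comm]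
  · rintro ⟨c, hc⟩ ⟨d, hd⟩
    exact ⟨c + d, by rw [mul_add, add_mul, hc, hd, add_smul]⟩

/-- The operator identity `C C* C` read from the row side: the density of one factor, applied to a
vector with coefficient matrix `c`, has coefficients `∑ j k, c i k * conj (c j k) * c j l`. -/
theorem mul_eq_sum_of_coefficients {n m m' : ℕ} {p g r : Matrix (Fin n) (Fin n) ℂ}
    {x : Fin m → Matrix (Fin n) (Fin n) ℂ} {y : Fin m' → Matrix (Fin n) (Fin n) ℂ}
    {c : Fin m → Fin m' → ℂ} {w : Fin m → Fin m → ℂ} {s : ℂ} (hp : p ≠ 0)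
    (hxy : ∀ i k, x i * y k * p = c i k • g)
    (hr : r * p = ∑ i, ∑ j, w j i • (star (x i) * (x j * p)))
    (hw : ∀ i j, w j i • p = ∑ k, star (x j * y k * p) * (x i * y k * p))
    (hg : star g * g = s • p)
    (hy : ∀ j, x j * p = ∑ l, star (y l) * (x j * y l * p)) :
    r * p = ∑ i, ∑ j, ∑ k, ∑ l,
      (star (c j k) * c i k * c j l * s) • (star (x i) * (star (y l) * g)) := by
  have hw' : ∀ i j, w j i = ∑ k, star (c j k) * c i k * s := by
    intro i j
    have h := hw i j
    simp only [hxy, star_smul, smul_mul_smul_comm, hg, smul_smul, ← Finset.sum_smul] at h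
    exact smul_left_injective ℂ hp h
  rw [hr]
  refine Finset.sum_congr rfl fun i _ => Finset.sum_congr rfl fun j _ => ?_
  rw [hw', hy, Finset.sum_smul]
  refine Finset.sum_congr rfl fun k _ => ?_
  rw [Finset.mul_sum, Finset.smul_sum]
  refine Finset.sum_congr rfl fun l _ => ?_
  rw [hxy, mul_smul_comm, mul_smul_comm, smul_smul]
  congr 1
  ring

theorem IsRestriction.mul_eq_sum_frame {n m : ℕ}
    {X : StarSubalgebra ℂ (Matrix (Fin n) (Fin n) ℂ)} {τ : Matrix (Fin n) (Fin n) ℂ →ₗ[ℂ] ℂ}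
    {ρ r p e : Matrix (Fin n) (Fin n) ℂ} {x : Fin m → Matrix (Fin n) (Fin n) ℂ}
    (hτ : IsCanonicalTrace X τ) (hr : IsRestriction X τ ρ r) (he : IsMinProjOf X e)
    (hxX : ∀ i, x i ∈ X) (hex : ∀ i, e * x i = x i)
    (hz : ∀ b ∈ X, (∑ i, star (x i) * x i) * b = b * ∑ i, star (x i) * x i)
    (hzp : (∑ i, star (x i) * x i) * p = p) :
    r * p = ∑ i, ∑ j, (ρ * (star (x j) * x i)).trace • (star (x i) * (x j * p)) := by
  have hes : star e = e := he.2.1.1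
  have hxe : ∀ i, star (x i) * e = star (x i) := fun i => by
    have := congrArg star (hex i)
    rwa [star_mul, hes] at this
  have key : ∀ i j, x i * r * star (x j) = (ρ * (star (x j) * x i)).trace • e := by
    intro i j
    have hm : r * star (x j) ∈ X := mul_mem hr.1 (star_mem (hxX j))
    have h := hτ.mul_mul_eq_smul he (mul_mem (hxX i) hm)
    have h1 : e * (x i * (r * star (x j))) = x i * (r * star (x j)) := by
      rw [← mul_assoc, hex]
    rw [h1, hτ.1 _ (hxX i) _ hm, mul_assoc r, hr.2.2 _ (mul_mem (star_mem (hxX j)) (hxX i))] at h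
    rw [← h]
    simp only [mul_assoc, hxe]
  calc r * p = (∑ i, star (x i) * x i) * r * ((∑ j, star (x j) * x j) * p) := by
        rw [hz r hr.1, hzp, mul_assoc, hzp]
    _ = ∑ i, ∑ j, star (x i) * (x i * r * star (x j)) * (x j * p) := by
        simp only [Finset.sum_mul, Finset.mul_sum, mul_assoc]
        exact Finset.sum_comm
    _ = _ := by
        simp only [key, mul_smul_comm, smul_mul_assoc, hxe]

theorem mul_eq_sum_star_mul {n m : ℕ} {a p : Matrix (Fin n) (Fin n) ℂ}
    {y : Fin m → Matrix (Fin n) (Fin n) ℂ} (h : ∀ l, a * star (y l) = star (y l) * a)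
    (hz : (∑ k, star (y k) * y k) * p = p) : a * p = ∑ l, star (y l) * (a * y l * p) := by
  conv_lhs => rw [← hz, ← mul_assoc, Finset.mul_sum, Finset.sum_mul]
  refine Finset.sum_congr rfl fun l _ => ?_
  rw [← mul_assoc a, h]
  simp only [mul_assoc]

theorem gram_smul_eq_sum {n m m' : ℕ} {p : Matrix (Fin n) (Fin n) ℂ}
    {x : Fin m → Matrix (Fin n) (Fin n) ℂ} {y : Fin m' → Matrix (Fin n) (Fin n) ℂ}
    {c : ℂ} {i j : Fin m} (hps : star p = p) (hc : p * (star (x j) * x i) * p = c • p)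
    (h1 : ∀ a k, x a * y k = y k * x a) (h2 : ∀ a k, x a * star (y k) = star (y k) * x a)
    (hz : (∑ k, star (y k) * y k) * p = p) :
    c • p = ∑ k, star (x j * y k * p) * (x i * y k * p) := by
  rw [← hc, mul_assoc, mul_assoc, mul_eq_sum_star_mul (h2 i) hz, ← mul_assoc, Finset.mul_sum]
  refine Finset.sum_congr rfl fun k _ => ?_
  rw [h1 j k]
  simp only [star_mul, hps, mul_assoc]

theorem restriction_mul_eq_of_minProj {n : ℕ} {ρ p : Matrix (Fin n) (Fin n) ℂ}
    {X Y : StarSubalgebra ℂ (Matrix (Fin n) (Fin n) ℂ)} (hXY : CompatibleAlg X Y)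
    (hp : IsMinProjOf (X ⊔ Y) p) (hpρ : ∀ a ∈ X ⊔ Y, p * a * p = (ρ * a).trace • p)
    {τX τY : Matrix (Fin n) (Fin n) ℂ →ₗ[ℂ] ℂ} {rX rY : Matrix (Fin n) (Fin n) ℂ}
    (hτX : IsCanonicalTrace X τX) (hτY : IsCanonicalTrace Y τY)
    (hrX : IsRestriction X τX ρ rX) (hrY : IsRestriction Y τY ρ rY) :
    rX * p = rY * p := by
  have hps : star p = p := hp.2.1.1
  have hpp : p * p = p := hp.2.1.2
  have hp0 : p ≠ 0 := hp.2.2.1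
  have hXA : ∀ {a}, a ∈ X → a ∈ X ⊔ Y := fun h => (le_sup_left : X ≤ X ⊔ Y) h
  have hYA : ∀ {a}, a ∈ Y → a ∈ X ⊔ Y := fun h => (le_sup_right : Y ≤ X ⊔ Y) h
  obtain ⟨f, hf, hfp⟩ := exists_isMinProjOf_mul_ne_zero Y hp0
  obtain ⟨e, he, hefp⟩ := exists_isMinProjOf_mul_ne_zero X hfp
  have hes : star e = e := he.2.1.1
  have hee : e * e = e := he.2.1.2
  have hfs : star f = f := hf.2.1.1
  have hff : f * f = f := hf.2.1.2
  have hef : e * f = f * e := hXY e he.1 f hf.1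
  have hep : e * p ≠ 0 := fun h => hefp (by rw [← mul_assoc, hef, mul_assoc, h, mul_zero])
  obtain ⟨m, x, hxX, hex, hzX, hze⟩ := he.exists_frame
  obtain ⟨m', y, hyY, hfy, hzY, hzf⟩ := hf.exists_frame
  have hnz : ∀ q ∈ X ⊔ Y, star q = q → q * q = q → q * p ≠ 0 → (ρ * q).trace ≠ 0 := by
    intro q hq hqs hqq hqp h0
    have h := hpρ q hq
    rw [h0, zero_smul] at h
    apply hqp
    rw [← Matrix.conjTranspose_mul_self_eq_zero, ← star_eq_conjTranspose, star_mul, hps, hqs]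
    rw [← h, ← mul_assoc, mul_assoc p q q, hqq]
  have hfix : ∀ z q : Matrix (Fin n) (Fin n) ℂ, q ∈ X ⊔ Y → z * p = p * z → z * q = q →
      (ρ * q).trace ≠ 0 → z * p = p := by
    intro z q hq hzp hzq h0
    have h := hpρ q hq
    have h1 : z * (p * q * p) = p * q * p := by
      rw [← mul_assoc, ← mul_assoc, hzp, mul_assoc p z q, hzq]
    rw [h, mul_smul_comm] at h1
    exact smul_right_injective _ h0 h1
  have hcen : ∀ z : Matrix (Fin n) (Fin n) ℂ, star z = z → (∀ b ∈ X, z * b = b * z) →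
      (∀ b ∈ Y, z * b = b * z) → z * p = p * z := by
    intro z hzs h1 h2
    have hle : X ⊔ Y ≤ StarSubalgebra.centralizer ℂ {z} := by
      refine sup_le (fun b hb => ?_) (fun b hb => ?_) <;>
        rw [StarSubalgebra.mem_centralizer_iff] <;> rintro _ rfl <;> rw [hzs]
      · exact ⟨h1 b hb, h1 b hb⟩
      · exact ⟨h2 b hb, h2 b hb⟩
    exact (StarSubalgebra.mem_centralizer_iff ℂ |>.1 (hle hp.1) z rfl).1
  have hzpX : (∑ i, star (x i) * x i) * p = p := by
    refine hfix _ e (hXA he.1) (hcen _ (by simp [star_sum]) hzX fun b hb => ?_) hze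
      (hnz e (hXA he.1) hes hee hep)
    exact hXY _ (sum_mem fun i _ => mul_mem (star_mem (hxX i)) (hxX i)) b hb
  have hzpY : (∑ k, star (y k) * y k) * p = p := by
    refine hfix _ f (hYA hf.1) (hcen _ (by simp [star_sum]) (fun b hb => ?_) hzY) hzf
      (hnz f (hYA hf.1) hfs hff hfp)
    exact (hXY b hb _ (sum_mem fun i _ => mul_mem (star_mem (hyY i)) (hyY i))).symm
  have hefA : e * f ∈ X ⊔ Y := mul_mem (hXA he.1) (hYA hf.1)
  have hefs : star (e * f) = e * f := by rw [star_mul, hes, hfs, hef]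
  have hefef : e * f * (e * f) = e * f := by
    rw [mul_assoc, ← mul_assoc f, ← hef, mul_assoc e, hff, ← mul_assoc, hee]
  set P := (ρ * (e * f)).trace with hP
  have hP0 : P ≠ 0 := hnz _ hefA hefs hefef (by rwa [mul_assoc])
  have hcorner : ∀ a ∈ X ⊔ Y, e * f * a = a → a * p = (ρ * a).trace • (P⁻¹ • (e * f * p)) := by
    intro a ha hea
    obtain ⟨c, hc⟩ := exists_smul_of_mem_sup hXY he hf (mul_mem ha hp.1)
    rw [← mul_assoc (e * f), hea] at hc
    have h1 : p * (a * p * (e * f)) * p = p * (c • (e * f)) * p := by rw [hc]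
    have h2 : p * (a * p * (e * f)) * p = ((ρ * a).trace * P) • p := by
      calc p * (a * p * (e * f)) * p = (p * a * p) * (p * (e * f) * p) := by
            simp only [mul_assoc]; rw [← mul_assoc p p, hpp]
        _ = _ := by rw [hpρ a ha, hpρ _ hefA, smul_mul_smul_comm, hpp]
    rw [h2, mul_smul_comm, smul_mul_assoc, hpρ _ hefA, smul_smul] at h1
    have h3 := smul_left_injective ℂ hp0 h1
    have hcω : c = (ρ * a).trace := (mul_right_cancel₀ hP0 h3).symm
    have h4 : a * p * (e * f) * p = P • (a * p) := by
      calc a * p * (e * f) * p = a * (p * (e * f) * p) := by simp only [mul_assoc]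
        _ = _ := by rw [hpρ _ hefA, mul_smul_comm]
    rw [hc, smul_mul_assoc, hcω] at h4
    rw [smul_comm, h4, smul_smul, inv_mul_cancel₀ hP0, one_smul]
  let g := P⁻¹ • (e * f * p)
  have hgg : star g * g = (star P⁻¹ * P⁻¹ * P) • p := by
    simp only [g, star_smul, smul_mul_smul_comm]
    rw [star_mul, hps, hefs, ← mul_assoc, mul_assoc p, hefef, hpρ _ hefA, smul_smul]
  have hxy : ∀ a ∈ X, ∀ b ∈ Y, e * a = a → f * b = b →
      a * b * p = (ρ * (a * b)).trace • g := by
    intro a ha b hb hea hfb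
    refine hcorner _ (mul_mem (hXA ha) (hYA hb)) ?_
    rw [mul_assoc e, ← mul_assoc f, ← hXY a ha f hf.1, mul_assoc a, hfb, ← mul_assoc, hea]
  have hX := mul_eq_sum_of_coefficients (x := x) (y := y)
    (c := fun i k => (ρ * (x i * y k)).trace) hp0
    (fun i k => hxy _ (hxX i) _ (hyY k) (hex i) (hfy k))
    (hrX.mul_eq_sum_frame hτX he hxX hex hzX hzpX)
    (fun i j => gram_smul_eq_sum hps (hpρ _ (mul_mem (hXA (star_mem (hxX j))) (hXA (hxX i))))
      (fun a k => hXY _ (hxX a) _ (hyY k)) (fun a k => hXY _ (hxX a) _ (star_mem (hyY k))) hzpY)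
    hgg (fun j => mul_eq_sum_star_mul (fun l => hXY _ (hxX j) _ (star_mem (hyY l))) hzpY)
  have hY := mul_eq_sum_of_coefficients (x := y) (y := x)
    (c := fun k i => (ρ * (x i * y k)).trace) hp0
    (fun k i => by
      rw [← hXY _ (hxX i) _ (hyY k)]
      exact hxy _ (hxX i) _ (hyY k) (hex i) (hfy k))
    (hrY.mul_eq_sum_frame hτY hf hyY hfy hzY hzpY)
    (fun i j => gram_smul_eq_sum hps (hpρ _ (mul_mem (hYA (star_mem (hyY j))) (hYA (hyY i))))
      (fun a k => (hXY _ (hxX k) _ (hyY a)).symm)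
      (fun a k => (hXY _ (star_mem (hxX k)) _ (hyY a)).symm) hzpX)
    hgg (fun j => mul_eq_sum_star_mul (fun l => (hXY _ (star_mem (hxX l)) _ (hyY j)).symm) hzpX)
  rw [hX, hY]
  have hL : ∀ F : Fin m → Fin m → Fin m' → Fin m' → Matrix (Fin n) (Fin n) ℂ,
      ∑ i, ∑ j, ∑ k, ∑ l, F i j k l = ∑ l, ∑ k, ∑ j, ∑ i, F i j k l := by
    intro F
    calc ∑ i, ∑ j, ∑ k, ∑ l, F i j k l = ∑ i, ∑ j, ∑ l, ∑ k, F i j k l :=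
          Finset.sum_congr rfl fun i _ => Finset.sum_congr rfl fun j _ => Finset.sum_comm
      _ = ∑ i, ∑ l, ∑ j, ∑ k, F i j k l := Finset.sum_congr rfl fun i _ => Finset.sum_comm
      _ = ∑ l, ∑ i, ∑ j, ∑ k, F i j k l := Finset.sum_comm
      _ = ∑ l, ∑ i, ∑ k, ∑ j, F i j k l :=
          Finset.sum_congr rfl fun l _ => Finset.sum_congr rfl fun i _ => Finset.sum_comm
      _ = ∑ l, ∑ k, ∑ i, ∑ j, F i j k l := Finset.sum_congr rfl fun l _ => Finset.sum_comm
      _ = ∑ l, ∑ k, ∑ j, ∑ i, F i j k l :=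
          Finset.sum_congr rfl fun l _ => Finset.sum_congr rfl fun k _ => Finset.sum_comm
  rw [hL]
  refine Finset.sum_congr rfl fun l _ => Finset.sum_congr rfl fun k _ =>
    Finset.sum_congr rfl fun j _ => Finset.sum_congr rfl fun i _ => ?_
  rw [← mul_assoc (star (x i)), hXY _ (star_mem (hxX i)) _ (star_mem (hyY l)),
    mul_assoc (star (y l))]
  congr 1
  ring

theorem matLogb_eq_aeval {n : ℕ} {A : Matrix (Fin n) (Fin n) ℂ} (hA : A.IsHermitian)
    {P : Polynomial ℂ}
    (hP : ∀ i, P.eval (hA.eigenvalues i : ℂ) = (Real.logb 2 (hA.eigenvalues i) : ℂ)) :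
    matLogb A = Polynomial.aeval A P := by
  rw [matLogb, dif_pos hA, ← IsHermitian.conj_diagonal_eval_eq_aeval hA]
  simp only [hP]

theorem aeval_mul_eq_of_commute {n : ℕ} {a b p : Matrix (Fin n) (Fin n) ℂ}
    (hab : a * b = b * a) (h : a * p = b * p) (P : Polynomial ℂ) :
    Polynomial.aeval a P * p = Polynomial.aeval b P * p := by
  induction P using Polynomial.induction_on' with
  | add f g hf hg => rw [map_add, map_add, add_mul, add_mul, hf, hg]
  | monomial k c =>
    rw [Polynomial.aeval_monomial, Polynomial.aeval_monomial, mul_assoc, mul_assoc]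
    congr 1
    induction k with
    | zero => simp
    | succ k ih =>
      rw [pow_succ, mul_assoc, h, ← mul_assoc, ((show Commute a b from hab).pow_left k).eq,
        mul_assoc, ih, ← mul_assoc, ← pow_succ']

theorem IsRestriction.trace_mul_matLogb_smul {n : ℕ} {ρ p r : Matrix (Fin n) (Fin n) ℂ}
    {X A : StarSubalgebra ℂ (Matrix (Fin n) (Fin n) ℂ)} (hXA : X ≤ A)
    (hpρ : ∀ a ∈ A, p * a * p = (ρ * a).trace • p)
    {τ : Matrix (Fin n) (Fin n) ℂ →ₗ[ℂ] ℂ} (hr : IsRestriction X τ ρ r) {P : Polynomial ℂ}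
    (hP : matLogb r = Polynomial.aeval r P) :
    τ (r * matLogb r) • p = p * (Polynomial.aeval r P * p) := by
  have hmem : Polynomial.aeval r P ∈ X :=
    Algebra.adjoin_le (S := X.toSubalgebra) (Set.singleton_subset_iff.2 hr.1)
      (Polynomial.aeval_mem_adjoin_singleton (R := ℂ) (p := P) r)
  rw [hP, hr.2.2 _ hmem, ← hpρ _ (hXA hmem), mul_assoc]

/-- if the restriction of `ρ` to `𝔛𝔜` is a pure state (a minimal
projection of `𝔛𝔜`), then `H_ρ(𝔛) = H_ρ(𝔜)`. -/
theorem pure_common_state_equal_entropies {n : ℕ}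
    (ρ : Matrix (Fin n) (Fin n) ℂ) (hρ : MatState ρ)
    (𝔛 𝔜 : StarSubalgebra ℂ (Matrix (Fin n) (Fin n) ℂ))
    (hcomp : CompatibleAlg 𝔛 𝔜)
    (τXY : Matrix (Fin n) (Fin n) ℂ →ₗ[ℂ] ℂ) (rXY : Matrix (Fin n) (Fin n) ℂ)
    (hτXY : IsCanonicalTrace (𝔛 ⊔ 𝔜) τXY)
    (hrXY : IsRestriction (𝔛 ⊔ 𝔜) τXY ρ rXY)
    (hpure : IsMinProjOf (𝔛 ⊔ 𝔜) rXY)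
    (HX HY : ℝ)
    (hHX : IsAlgEntropy 𝔛 ρ HX) (hHY : IsAlgEntropy 𝔜 ρ HY) :
    HX = HY := by
  have hpρ : ∀ a ∈ 𝔛 ⊔ 𝔜, rXY * a * rXY = (ρ * a).trace • rXY := fun a ha => by
    rw [hτXY.mul_mul_eq_smul hpure ha, hrXY.2.2 a ha]
  obtain ⟨τX, rX, hτX, hrX, rfl⟩ := hHX
  obtain ⟨τY, rY, hτY, hrY, rfl⟩ := hHY
  have hr := restriction_mul_eq_of_minProj hcomp hpure hpρ hτX hτY hrX hrY
  have hX : rX.IsHermitian := hrX.2.1.1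
  have hY : rY.IsHermitian := hrY.2.1.1
  classical
  let s : Finset ℂ := Finset.univ.image (fun i => (hX.eigenvalues i : ℂ)) ∪
    Finset.univ.image (fun i => (hY.eigenvalues i : ℂ))
  let P : Polynomial ℂ := Lagrange.interpolate s id (fun z => (Real.logb 2 z.re : ℂ))
  have hP : ∀ z ∈ s, P.eval z = (Real.logb 2 z.re : ℂ) := fun z hz =>
    Lagrange.eval_interpolate_at_node (v := id) (fun z : ℂ => (Real.logb 2 z.re : ℂ))
      (Set.injOn_id _) hz
  have hPX := matLogb_eq_aeval hX (P := P) fun i => by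
    rw [hP _ (Finset.mem_union_left _ (Finset.mem_image_of_mem _ (Finset.mem_univ i))),
      Complex.ofReal_re]
  have hPY := matLogb_eq_aeval hY (P := P) fun i => by
    rw [hP _ (Finset.mem_union_right _ (Finset.mem_image_of_mem _ (Finset.mem_univ i))),
      Complex.ofReal_re]
  have hXs := hrX.trace_mul_matLogb_smul le_sup_left hpρ hPX
  have hYs := hrY.trace_mul_matLogb_smul le_sup_right hpρ hPY
  rw [aeval_mul_eq_of_commute (hcomp _ hrX.1 _ hrY.1) hr, ← hYs] at hXs
  rw [algEntropy, algEntropy, smul_left_injective ℂ hpure.2.2.1 hXs]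
end
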